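/- Let D be a dataset of real numbers with |D| = n, let t be a positive integer with t < n, and let a, b be integers with a ≥ t and b ≤ n − t. Suppose l' is a rank-a threshold for D and u' is a rank-b threshold for D. Then every x ∈ L_t(D) satisfies x ≤ l', every x ∈ U_t(D) satisfies x ≥ u', and consequently μ(D \ L_t(D)) − μ(D \ U_t(D)) ≥ t·(u' − l')/(n − t). -/

import Mathlib

open MeasureTheory Multiset

noncomputable section

/-- Add/remove distance between multisets. -/
def mdist (D D' : Multiset ℝ) : ℕ := (D - D').card + (D' - D).card

/-- Neighboring datasets. -/
def Neighboring (D D' : Multiset ℝ) : Prop := mdist D D' = 1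

/-- `A` is an `ε`-differentially private randomized algorithm. -/
def IsDP (A : Multiset ℝ → Measure ℝ) (ε : ℝ) : Prop :=
  (∀ D, IsProbabilityMeasure (A D)) ∧
  ∀ D D' : Multiset ℝ, Neighboring D D' → ∀ S : Set ℝ, MeasurableSet S →
    A D S ≤ ENNReal.ofReal (Real.exp ε) * A D' S

/-- Mean of a dataset. -/
def mmean (D : Multiset ℝ) : ℝ := D.sum / D.card

/-- The multiset of the `m` smallest elements of `D`. -/
def lowerM (m : ℕ) (D : Multiset ℝ) : Multiset ℝ := ((D.sort (· ≤ ·)).take m : List ℝ)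

/-- The multiset of the `m` largest elements of `D`. -/
def upperM (m : ℕ) (D : Multiset ℝ) : Multiset ℝ := ((D.sort (· ≤ ·)).drop (D.card - m) : List ℝ)

/-- Subset-based risk for mean estimation. -/
def meanRisk (D : Multiset ℝ) (ε : ℝ) : ℝ :=
  ⨅ A : {A : Multiset ℝ → Measure ℝ // IsDP A ε},
    ⨆ D' : {D' : Multiset ℝ // D' ≤ D ∧ (D.card : ℝ) - 1/ε ≤ D'.card},
      ∫ y, |y - mmean D'.1| ∂(A.1 D'.1)
/-- Number of elements of `D` strictly below `τ` (with multiplicity). -/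
def countLt (D : Multiset ℝ) (τ : ℝ) : ℕ := (D.filter (fun x => x < τ)).card

/-- Number of elements of `D` at most `τ` (with multiplicity). -/
def countLe (D : Multiset ℝ) (τ : ℝ) : ℕ := (D.filter (fun x => x ≤ τ)).card

/-- `τ` is a rank-`r` threshold for `D`. -/
def IsRankThreshold (τ : ℝ) (r : ℕ) (D : Multiset ℝ) : Prop :=
  countLt D τ ≤ r ∧ r ≤ countLe D τ

theorem length_lt_countP_append_of_pred {α : Type*} (p : α → Prop) [DecidablePred p]
    {l₁ l₂ : List α} {x : α} (h₁ : ∀ y ∈ l₁, p y) (hx : x ∈ l₂) (hpx : p x) :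
    l₁.length + 1 ≤ (l₁ ++ l₂).countP (p ·) := by
  have h₂ : 0 < l₂.countP (p ·) := List.countP_pos_iff.2 ⟨x, hx, by simpa using hpx⟩
  have h₃ : l₁.countP (p ·) = l₁.length := List.countP_eq_length.2 (by simpa using h₁)
  rw [List.countP_append]
  omega

theorem countP_append_lt_of_not_pred {α : Type*} (p : α → Prop) [DecidablePred p]
    {l₁ l₂ : List α} {x : α} (hx : x ∈ l₁) (hpx : ¬ p x) (h₂ : ∀ y ∈ l₂, ¬ p y) :
    (l₁ ++ l₂).countP (p ·) < l₁.length := by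
  have h₃ : l₂.countP (p ·) = 0 := List.countP_eq_zero.2 (by simpa using h₂)
  have h₁ : l₁.countP (p ·) ≠ l₁.length := fun h =>
    hpx (by simpa using List.countP_eq_length.1 h x hx)
  have := List.countP_le_length (p := (p ·)) (l := l₁)
  rw [List.countP_append]
  omega

theorem sort_take_le_drop (D : Multiset ℝ) (k : ℕ) :
    ∀ x ∈ (D.sort (· ≤ ·)).take k, ∀ y ∈ (D.sort (· ≤ ·)).drop k, x ≤ y := by
  have h := D.pairwise_sort (· ≤ ·)
  rw [← List.take_append_drop k (D.sort (· ≤ ·)), List.pairwise_append] at h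
  exact h.2.2

theorem card_filter_eq_countP_sort (D : Multiset ℝ) (k : ℕ) (p : ℝ → Prop) [DecidablePred p] :
    (D.filter p).card =
      ((D.sort (· ≤ ·)).take k ++ (D.sort (· ≤ ·)).drop k).countP (p ·) := by
  rw [List.take_append_drop, ← Multiset.countP_eq_card_filter, ← Multiset.coe_countP,
    Multiset.sort_eq]

theorem lowerM_le (m : ℕ) (D : Multiset ℝ) : lowerM m D ≤ D := by
  conv_rhs => rw [← D.sort_eq (· ≤ ·)]
  exact Multiset.coe_le.2 (List.take_sublist _ _).subperm

theorem upperM_le (m : ℕ) (D : Multiset ℝ) : upperM m D ≤ D := by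
  conv_rhs => rw [← D.sort_eq (· ≤ ·)]
  exact Multiset.coe_le.2 (List.drop_sublist _ _).subperm

theorem card_lowerM {m : ℕ} {D : Multiset ℝ} (h : m ≤ D.card) : (lowerM m D).card = m := by
  simp [lowerM, h]

theorem card_upperM {m : ℕ} {D : Multiset ℝ} (h : m ≤ D.card) : (upperM m D).card = m := by
  simp only [upperM, Multiset.coe_card, List.length_drop, Multiset.length_sort]
  omega

theorem le_of_mem_lowerM {D : Multiset ℝ} {t : ℕ} {τ : ℝ} (h : t ≤ countLe D τ) :
    ∀ x ∈ lowerM t D, x ≤ τ := by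
  intro x hx
  by_contra hlt
  have hx' : x ∈ (D.sort (· ≤ ·)).take t := by simpa [lowerM] using hx
  have hc := countP_append_lt_of_not_pred (· ≤ τ) hx' hlt fun y hy hyτ =>
    hlt ((sort_take_le_drop D t x hx' y hy).trans hyτ)
  rw [← card_filter_eq_countP_sort] at hc
  have := List.length_take_le t (D.sort (· ≤ ·))
  unfold countLe at h
  omega

theorem le_of_mem_upperM {D : Multiset ℝ} {t : ℕ} {τ : ℝ} (h : countLt D τ ≤ D.card - t) :
    ∀ x ∈ upperM t D, τ ≤ x := by
  intro x hx
  by_contra! hlt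
  have hx' : x ∈ (D.sort (· ≤ ·)).drop (D.card - t) := by simpa [upperM] using hx
  have hc := length_lt_countP_append_of_pred (· < τ)
    (fun y hy => (sort_take_le_drop D _ y hy x hx').trans_lt hlt) hx' hlt
  rw [← card_filter_eq_countP_sort, List.length_take, Multiset.length_sort] at hc
  unfold countLt at h
  omega

theorem mmean_sub {D E : Multiset ℝ} (h : E ≤ D) :
    mmean (D - E) = (D.sum - E.sum) / ((D.card : ℝ) - E.card) := by
  obtain ⟨F, rfl⟩ := Multiset.le_iff_exists_add.1 h
  simp [mmean]

/-- thresholds of rank at least `t` (resp. at most `n − t`) lie above the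
`t` smallest (resp. below the `t` largest) points, and the two trimmed means differ by at
least `t (u' − l') / (n − t)`. -/
theorem rank_thresholds_trimmed_mean_gap (D : Multiset ℝ) (t : ℕ) (ht : 0 < t)
    (htn : t < D.card) (a b : ℕ) (ha : t ≤ a) (hb : b ≤ D.card - t)
    (l' u' : ℝ) (hl : IsRankThreshold l' a D) (hu : IsRankThreshold u' b D) :
    (∀ x ∈ lowerM t D, x ≤ l') ∧ (∀ x ∈ upperM t D, u' ≤ x) ∧
      (t : ℝ) * (u' - l') / ((D.card : ℝ) - t) ≤
        mmean (D - lowerM t D) - mmean (D - upperM t D) := by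
  have hL := le_of_mem_lowerM (ha.trans hl.2)
  have hU := le_of_mem_upperM (hu.1.trans hb)
  refine ⟨hL, hU, ?_⟩
  have hLs := Multiset.sum_le_card_nsmul _ _ hL
  have hUs := Multiset.card_nsmul_le_sum hU
  rw [card_lowerM htn.le, nsmul_eq_mul] at hLs
  rw [card_upperM htn.le, nsmul_eq_mul] at hUs
  have hpos : (0 : ℝ) < D.card - t := sub_pos.2 (by exact_mod_cast htn)
  rw [mmean_sub (lowerM_le t D), mmean_sub (upperM_le t D), card_lowerM htn.le,
    card_upperM htn.le, ← sub_div]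
  gcongr
  linarith
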